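/- Let n ≥ 2, 0 ≤ p ≤ n/2 and 2 − n + 2p < a ≤ 2. Then the point spectrum of the self-adjoint operator on Ḣ^{(2−a)/2,p}(ℝ^n) obtained as the closure of Δ_{a,p} contains the set {k(k + a − 1) : k ∈ ℕ, k < (1 − a)/2}; i.e., for every natural number k with k < (1 − a)/2 there exists a nonzero u ∈ Ḣ^{(2−a)/2,p}(ℝ^n) with Δ_{a,p} u = k(k + a − 1) u in the sense of tempered distributions. -/

import Mathlib

open MeasureTheory Complex Finset

noncomputable section

/-- Euclidean space ℝ^n -/
abbrev Rn (n : ℕ) := EuclideanSpace ℝ (Fin n)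

/-- The full exterior algebra Λ^•ℂ^n, realized as the Euclidean space with orthonormal
basis indexed by subsets of {1,…,n} (the basis e_S = e_{i_1}∧…∧e_{i_p}). -/
abbrev Lam (n : ℕ) := EuclideanSpace ℂ (Finset (Fin n))

variable {n : ℕ}

/-- the sign (-1)^{#{i ∈ S : i < j}} -/
def wsign (j : Fin n) (S : Finset (Fin n)) : ℂ := (-1) ^ (S.filter (· < j)).card

/-- exterior multiplication ε_x by x ∈ ℂ^n -/
def eps (x : Fin n → ℂ) (v : Lam n) : Lam n :=
  WithLp.toLp 2 fun S => ∑ j ∈ S, wsign j S * x j * v (S.erase j)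

/-- interior multiplication i_x by x ∈ ℂ^n (adjoint of ε_x for real x) -/
def iot (x : Fin n → ℂ) (v : Lam n) : Lam n :=
  WithLp.toLp 2 fun S => ∑ j ∈ Sᶜ, wsign j S * x j * v (insert j S)

/-- v lies in the degree-p part Λ^p ℂ^n ⊆ Λ^• ℂ^n -/
def IsForm (p : ℕ) (v : Lam n) : Prop := ∀ S, S.card ≠ p → v S = 0

/-- complexification of a real vector -/
def rc (x : Fin n → ℝ) : Fin n → ℂ := fun j => (x j : ℂ)

/-- the j-th standard basis vector of ℂ^n -/
def ee (j : Fin n) : Fin n → ℂ := fun i => if i = j then 1 else 0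

/-- extend x' ∈ ℝ^{n-1} by last coordinate t to the vector (x',t) ∈ ℝ^n -/
def app (x' : Rn (n-1)) (t : ℝ) : Rn n :=
  WithLp.toLp 2 fun j => if h : (j : ℕ) < n - 1 then x' ⟨j, h⟩ else t

/-- restriction ℝ^n → ℝ^{n-1}, x ↦ x' -/
def restr (ξ : Rn n) : Rn (n-1) := WithLp.toLp 2 fun i => ξ (Fin.castLE (Nat.sub_le n 1) i)

/-- the embedding Fin (n-1) ↪ Fin n -/
def embF : Fin (n-1) ↪ Fin n := ⟨Fin.castLE (Nat.sub_le n 1), (Fin.castLE_injective _)⟩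

/-- pullback Λ^• ℂ^n → Λ^• ℂ^{n-1}; on p-forms this is the projection i_{e_n} ε_{e_n}
followed by restriction of indices. -/
def projL (v : Lam n) : Lam (n-1) := WithLp.toLp 2 fun T => v (T.map embF)

/-- the inclusion Λ^• ℂ^{n-1} ⊆ Λ^• ℂ^n -/
def incL (v : Lam (n-1)) : Lam n :=
  WithLp.toLp 2 fun S => ∑ T : Finset (Fin (n-1)), if T.map embF = S then v T else 0

/-- the operator i_z ε_z - ε_z i_z -/
def cmm (z : Fin n → ℂ) (v : Lam n) : Lam n := iot z (eps z v) - eps z (iot z v)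

/-- partial derivative ∂/∂x_j -/
def pd (j : Fin n) (u : Rn n → Lam n) : Rn n → Lam n :=
  fun x => fderiv ℝ u x (EuclideanSpace.single j 1)

/-- the differential operator Δ_{a,p} = x_n²Δ + a x_n ∂_n + 2x_n(i_{e_n}d' - ε_{e_n}δ')
- (n-2p) ε_{e_n} i_{e_n}; here ℓ is the index of the last coordinate. -/
def Dap (a : ℝ) (p : ℕ) (ℓ : Fin n) (u : Rn n → Lam n) (x : Rn n) : Lam n :=
  ((x ℓ)^2 : ℝ) • (∑ j, pd j (pd j u) x)
  + (a * x ℓ) • pd ℓ u x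
  + (2 * x ℓ) • (iot (ee ℓ) (∑ j ∈ univ.erase ℓ, eps (ee j) (pd j u x))
      - eps (ee ℓ) (-(∑ j ∈ univ.erase ℓ, iot (ee j) (pd j u x))))
  - ((n : ℝ) - 2*p) • eps (ee ℓ) (iot (ee ℓ) (u x))

/-- the formal transpose of Δ_{a,p} with respect to the bilinear pairing
∫ ⟨u(x), φ(x)⟩ dx (⟨·,·⟩ the bilinear form with ⟨e_S, e_T⟩ = δ_{ST}):
Δ_{a,p}ᵗφ = Δ(x_n²φ) - a ∂_n(x_n φ) - 2x_n Σ_j (i_{e_j}ε_{e_n} + ε_{e_j}i_{e_n}) ∂_j φ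
- (n-2p) ε_{e_n} i_{e_n} φ. -/
def DapT (a : ℝ) (p : ℕ) (ℓ : Fin n) (φ : Rn n → Lam n) (x : Rn n) : Lam n :=
  (∑ j, pd j (pd j (fun y => ((y ℓ)^2 : ℝ) • φ y)) x)
  - a • pd ℓ (fun y => (y ℓ) • φ y) x
  - (2 * x ℓ) • (∑ j ∈ univ.erase ℓ,
      (iot (ee j) (eps (ee ℓ) (pd j φ x)) + eps (ee j) (iot (ee ℓ) (pd j φ x))))
  - ((n : ℝ) - 2*p) • eps (ee ℓ) (iot (ee ℓ) (φ x))

/-- the Fourier transform with the convention û(ξ) = (2π)^{-n/2} ∫ e^{-i x·ξ} u(x) dx -/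
def ft (u : Rn n → Lam n) : Rn n → Lam n := fun ξ =>
  ((2 * Real.pi) ^ (-(n:ℝ)/2) : ℝ) •
    ∫ x, Complex.exp (-(((∑ j, x j * ξ j : ℝ) : ℂ) * Complex.I)) • u x

/-- the inverse Fourier transform -/
def ftInv (u : Rn n → Lam n) : Rn n → Lam n := fun ξ =>
  ((2 * Real.pi) ^ (-(n:ℝ)/2) : ℝ) •
    ∫ x, Complex.exp ((((∑ j, x j * ξ j : ℝ) : ℂ) * Complex.I)) • u x

/-- The homogeneous Sobolev space Ḣ^{s,p}(ℝ^n) of Λ^pℂ^n-valued tempered distributions,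
modeled on the Fourier transform side: an element of the set is the function g = û. -/
def Hdot (n : ℕ) (s : ℝ) (p : ℕ) : Set (Rn n → Lam n) :=
  {g | AEStronglyMeasurable g volume ∧ (∀ ξ, IsForm p (g ξ)) ∧
    Integrable (fun ξ => ‖ξ‖ ^ (2*s) * ‖g ξ‖^2)}

/-- squared weighted L² norm ∫ ‖ξ‖^t ‖g(ξ)‖² dξ on the Fourier side;
wInt (2s) g is the squared homogeneous Sobolev norm of degree s of u with û = g. -/
def wInt (t : ℝ) (g : Rn n → Lam n) : ℝ := ∫ ξ, ‖ξ‖ ^ t * ‖g ξ‖^2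

/-- the operator (c - λ) i_x ε_x + (c + λ) ε_x i_x on Λ^•ℂ^n -/
def opC (c lam : ℝ) (x : Fin n → ℝ) (v : Lam n) : Lam n :=
  ((c - lam : ℝ) : ℂ) • iot (rc x) (eps (rc x) v)
    + ((c + lam : ℝ) : ℂ) • eps (rc x) (iot (rc x) v)

/-- the conformally invariant squared norm ‖u‖_λ² on the Fourier side (for û = g);
c is dim/2 - p, i.e. n/2 - p on ℝ^n and (n-1)/2 - p on ℝ^{n-1}. -/
def cSq (c lam : ℝ) (g : Rn n → Lam n) : ℝ :=
  ∫ ξ, ‖ξ‖ ^ (-(2*lam)) * (inner ℂ (g ξ) (opC c lam (WithLp.ofLp (‖ξ‖⁻¹ • ξ)) (g ξ)) : ℂ).re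

/-- the conformally invariant inner product on the Fourier side -/
def cIp (c lam : ℝ) (g h : Rn n → Lam n) : ℂ :=
  ∫ ξ, (‖ξ‖ ^ (-(2*lam)) : ℝ) • (inner ℂ (g ξ) (opC c lam (WithLp.ofLp (‖ξ‖⁻¹ • ξ)) (h ξ)) : ℂ)

/-- the bilinear pairing on Λ^•ℂ^n with ⟨e_S, e_T⟩ = δ_{ST} -/
def blin (v w : Lam n) : ℂ := ∑ S, v S * w S

/-- the pairing ⟨u, ψ⟩ of the tempered distribution u whose Fourier transform is g
with a Schwartz function ψ: ⟨u, ψ⟩ = ⟨û, 𝓕⁻¹ψ⟩ = ∫ ⟨g(ξ), (𝓕⁻¹ψ)(ξ)⟩ dξ. -/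
def dpair (g : Rn n → Lam n) (ψ : Rn n → Lam n) : ℂ :=
  ∫ ξ, blin (g ξ) (ftInv ψ ξ)

/-- "Δ_{a,p} u = μ u in the sense of tempered distributions", expressed for the
distribution u whose Fourier transform is g: testing against all Λ^•ℂ^n-valued
Schwartz functions φ via the formal transpose of Δ_{a,p}. -/
def WeakEig (a : ℝ) (p : ℕ) (ℓ : Fin n) (g : Rn n → Lam n) (μ : ℂ) : Prop :=
  ∀ φ : SchwartzMap (Rn n) (Lam n),
    dpair g (fun x => DapT a p ℓ (fun y => φ y) x - μ • φ x) = 0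

/-- the Fourier side of the trace map u ↦ u|_{ℝ^{n-1}}:
(Ru)^(ξ') = (2π)^{-1/2} ∫_ℝ û(ξ', ξ_n) dξ_n, composed with the pullback
Λ^pℂ^n → Λ^pℂ^{n-1}. -/
def ftrace (g : Rn n → Lam n) : Rn (n-1) → Lam (n-1) := fun ξ' =>
  ((2 * Real.pi) ^ (-(1:ℝ)/2) : ℝ) • ∫ t : ℝ, projL (g (app ξ' t))

/-- the constant c_{a,p} -/
def cP (n p : ℕ) (a : ℝ) : ℝ :=
  2 * Real.Gamma (((n:ℝ) - a + 2)/2) /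
    (Real.pi ^ (((n:ℝ)-1)/2) * ((n:ℝ) - 2*p - a) * Real.Gamma ((1-a)/2))

/-- the Poisson transform P_{a,p}f(x) = c_{a,p} ∫_{ℝ^{n-1}} |x_n|^{1-a}
(|x'-y|²+x_n²)^{-(n-a+2)/2} (i_{x-y}ε_{x-y} - ε_{x-y}i_{x-y}) f(y) dy,
where ℓ is the index of the last coordinate. -/
def Pois (a : ℝ) (p : ℕ) (ℓ : Fin n) (f : Rn (n-1) → Lam (n-1)) (x : Rn n) : Lam n :=
  cP n p a • ∫ y : Rn (n-1),
    (|x ℓ| ^ (1-a) * ‖x - app y 0‖ ^ (-((n:ℝ) - a + 2))) •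
      cmm (rc (WithLp.ofLp (x - app y 0))) (incL (f y))

/-- "G is the Fourier transform of the (polynomially bounded, locally integrable)
function u in the sense of tempered distributions":
∫ ⟨G(ξ), ψ(ξ)⟩ dξ = ∫ ⟨u(x), ψ̂(x)⟩ dx for every Schwartz function ψ. -/
def IsFTof (G : Rn n → Lam n) (u : Rn n → Lam n) : Prop :=
  ∀ ψ : SchwartzMap (Rn n) (Lam n),
    ∫ ξ, blin (G ξ) (ψ ξ) = ∫ x, blin (u x) (ft (fun y => ψ y) x)

section Aux
open scoped FourierTransform LineDeriv

/-- multiplication by the coordinate `x_ℓ` on Schwartz space -/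
def XX (ℓ : Fin n) (φ : SchwartzMap (Rn n) (Lam n)) : SchwartzMap (Rn n) (Lam n) :=
  SchwartzMap.smulLeftCLM (Lam n) (fun y : Rn n => inner ℝ y (EuclideanSpace.single ℓ 1)) φ

/-- partial derivative on Schwartz space -/
def DD (j : Fin n) (φ : SchwartzMap (Rn n) (Lam n)) : SchwartzMap (Rn n) (Lam n) :=
  ∂_{(EuclideanSpace.single j 1 : Rn n)} φ

lemma XX_apply (ℓ : Fin n) (φ : SchwartzMap (Rn n) (Lam n)) (x : Rn n) :
    XX ℓ φ x = (x ℓ) • φ x := by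
  have : (fun y : Rn n => inner ℝ y (EuclideanSpace.single ℓ (1:ℝ))).HasTemperateGrowth := by
    fun_prop
  rw [XX, SchwartzMap.smulLeftCLM_apply_apply this]
  simp [EuclideanSpace.inner_single_right]

lemma pd_eq (j : Fin n) (φ : SchwartzMap (Rn n) (Lam n)) :
    pd j (fun y => φ y) = fun y => DD j φ y := by
  rfl

lemma ftInv_eq (φ : SchwartzMap (Rn n) (Lam n)) (ξ : Rn n) :
    ftInv (fun x => φ x) ξ =
      ((2 * Real.pi) ^ (-(n:ℝ)/2) : ℝ) • (𝓕⁻ φ : SchwartzMap (Rn n) (Lam n)) ((2*Real.pi)⁻¹ • ξ) := by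
  rw [SchwartzMap.fourierInv_coe, Real.fourierInv_eq', ftInv]
  congr 1
  apply integral_congr_ae
  refine Filter.Eventually.of_forall fun x => ?_
  simp only
  congr 3
  rw [inner_smul_right]
  have : inner ℝ x ξ = ∑ j, x j * ξ j := by
    simp [PiLp.inner_apply, mul_comm]
  rw [this, ← mul_assoc, mul_inv_cancel₀ (by positivity), one_mul]

lemma ftInv_DD (j : Fin n) (φ : SchwartzMap (Rn n) (Lam n)) (ξ : Rn n) :
    ftInv (fun x => DD j φ x) ξ = (-(I * (ξ j : ℂ))) • ftInv (fun x => φ x) ξ := by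
  have : (fun y : Rn n => inner ℝ y (EuclideanSpace.single j (1:ℝ))).HasTemperateGrowth := by
    fun_prop
  rw [ftInv_eq, ftInv_eq, DD, SchwartzMap.fourierInv_lineDerivOp_eq, smul_comm (-(I * (ξ j : ℂ)))]
  congr 1
  rw [_root_.smul_apply, SchwartzMap.smulLeftCLM_apply_apply this]
  rw [← Complex.coe_smul, smul_smul]
  congr 1
  simp [EuclideanSpace.inner_single_right]
  field_simp

/-- the straight line in direction `e_ℓ` -/
lemma ftInv_XX (ℓ : Fin n) (φ : SchwartzMap (Rn n) (Lam n)) (ξ : Rn n) (t : ℝ) :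
    HasDerivAt (fun t : ℝ => ftInv (fun x => φ x) (ξ + t • EuclideanSpace.single ℓ 1))
      (I • ftInv (fun x => XX ℓ φ x) (ξ + t • EuclideanSpace.single ℓ 1)) t := by
  simp_rw [ftInv_eq]
  rw [smul_comm]
  apply HasDerivAt.fun_const_smul
  have h1 := ((𝓕⁻ φ : SchwartzMap (Rn n) (Lam n)).differentiable
    ((2*Real.pi)⁻¹ • (ξ + t • EuclideanSpace.single ℓ 1))).hasFDerivAt
  have h2 : HasDerivAt (fun t : ℝ => (2*Real.pi)⁻¹ • (ξ + t • (EuclideanSpace.single ℓ 1 : Rn n)))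
      ((2*Real.pi)⁻¹ • (EuclideanSpace.single ℓ 1 : Rn n)) t := by
    have := ((hasDerivAt_id t).smul_const (EuclideanSpace.single ℓ 1 : Rn n)).const_add ξ
    rw [one_smul] at this
    exact this.fun_const_smul (2*Real.pi)⁻¹
  have h3 := h1.comp_hasDerivAt t h2
  refine h3.congr_deriv ?_
  rw [ContinuousLinearMap.map_smul, ← SchwartzMap.lineDerivOp_apply_eq_fderiv, SchwartzMap.lineDerivOp_fourierInv_eq,
    FourierTransform.fourierInv_smul, _root_.smul_apply, ← Complex.coe_smul, smul_smul]
  rw [XX]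
  congr 1
  push_cast
  field_simp

lemma ftInv_tendsto (φ : SchwartzMap (Rn n) (Lam n)) :
    Filter.Tendsto (ftInv (fun x => φ x)) (Filter.cocompact _) (nhds 0) := by
  have h0 : ftInv (fun x => φ x) = fun ξ => ((2 * Real.pi) ^ (-(n:ℝ)/2) : ℝ) •
      (𝓕⁻ φ : SchwartzMap (Rn n) (Lam n)) ((2*Real.pi)⁻¹ • ξ) := by
    funext ξ; exact ftInv_eq φ ξ
  rw [h0]
  have h1 := (SchwartzMap.toZeroAtInfty (𝓕⁻ φ : SchwartzMap (Rn n) (Lam n))).zero_at_infty'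
  have h2 : Filter.Tendsto (fun ξ : Rn n => (2*Real.pi)⁻¹ • ξ) (Filter.cocompact _)
      (Filter.cocompact _) :=
    (Homeomorph.smulOfNeZero ((2*Real.pi)⁻¹ : ℝ) (by positivity)).isClosedEmbedding.tendsto_cocompact
  have h3 := (h1.comp h2).const_smul ((2 * Real.pi) ^ (-(n:ℝ)/2) : ℝ)
  simpa using h3

lemma line_tendsto (ℓ : Fin n) (ξ : Rn n) :
    Filter.Tendsto (fun t : ℝ => ξ + t • (EuclideanSpace.single ℓ 1 : Rn n)) (Filter.cocompact _)
      (Filter.cocompact _) := by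
  rw [← Metric.cobounded_eq_cocompact (α := Rn n), ← tendsto_norm_atTop_iff_cobounded]
  have h1 : ∀ t : ℝ, ‖t‖ - ‖ξ‖ ≤ ‖ξ + t • (EuclideanSpace.single ℓ 1 : Rn n)‖ := by
    intro t
    have := norm_sub_norm_le (t • (EuclideanSpace.single ℓ 1 : Rn n)) (-ξ)
    rw [norm_smul] at this
    simpa [add_comm] using this
  refine Filter.tendsto_atTop_mono h1 ?_
  exact Filter.tendsto_atTop_add_const_right _ _ (tendsto_norm_cocompact_atTop)

/-! ### the polynomial solution -/
open Polynomial in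
lemma exists_poly (a : ℝ) (k : ℕ) : ∃ q : Polynomial ℝ, q ≠ 0 ∧ q.natDegree ≤ k ∧
    (1 + X^2) * derivative (derivative q) + C a * X * derivative q
      = C ((k:ℝ) * ((k:ℝ) + a - 1)) * q := by
  let T : ℝ[X] →ₗ[ℝ] ℝ[X] :=
    LinearMap.mulLeft ℝ (1 + X^2) ∘ₗ derivative ∘ₗ derivative
      + LinearMap.mulLeft ℝ (C a * X) ∘ₗ derivative
      - ((k:ℝ) * ((k:ℝ) + a - 1)) • LinearMap.id
  have hT : ∀ q, T q = (1 + X^2) * derivative (derivative q) + C a * X * derivative q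
      - C ((k:ℝ) * ((k:ℝ) + a - 1)) * q := by
    intro q
    simp [T, smul_eq_C_mul, mul_assoc]
  have hcoef : ∀ q j, (T q).coeff j = ((j:ℝ)+1) * ((j:ℝ)+2) * q.coeff (j+2)
      + ((j:ℝ) * ((j:ℝ) - 1) + a * j - (k:ℝ) * ((k:ℝ) + a - 1)) * q.coeff j := by
    intro q j
    rw [hT]
    have e1 : ((1 + X^2) * derivative (derivative q) + C a * X * derivative q
      - C ((k:ℝ) * ((k:ℝ) + a - 1)) * q) = derivative (derivative q)
        + derivative (derivative q) * X^2 + C a * (derivative q * X)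
        - C ((k:ℝ) * ((k:ℝ) + a - 1)) * q := by ring
    rw [e1, coeff_sub, coeff_add, coeff_add, coeff_C_mul, coeff_C_mul, coeff_mul_X_pow']
    rcases j with _ | _ | j
    · simp [coeff_derivative]; ring
    · simp [coeff_derivative, coeff_mul_X]; ring
    · simp [coeff_derivative, coeff_mul_X]; ring
  have hmap : ∀ q ∈ degreeLT ℝ (k+1), T q ∈ degreeLT ℝ k := by
    intro q hq
    rw [mem_degreeLT, degree_lt_iff_coeff_zero] at hq ⊢
    intro m hm
    rw [hcoef, hq (m+2) (by omega)]
    rcases hm.eq_or_lt with h | h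
    · subst h; ring
    · rw [hq m (by omega)]; ring
  let T' : degreeLT ℝ (k+1) →ₗ[ℝ] degreeLT ℝ k := T.restrict hmap
  have hfin : ∀ m, Module.finrank ℝ (degreeLT ℝ m) = m := by
    intro m
    rw [(degreeLTEquiv ℝ m).finrank_eq]; simp
  have hfd : ∀ m, FiniteDimensional ℝ (degreeLT ℝ m) := fun m =>
    Module.Finite.equiv (degreeLTEquiv ℝ m).symm
  have := hfd k
  have := hfd (k+1)
  have hker : LinearMap.ker T' ≠ ⊥ := LinearMap.ker_ne_bot_of_finrank_lt (by rw [hfin, hfin]; omega)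
  obtain ⟨q, hq, hq0⟩ := (Submodule.ne_bot_iff _).1 hker
  refine ⟨q.1, fun h => hq0 (Subtype.ext h), ?_, ?_⟩
  · have := q.2
    rw [mem_degreeLT] at this
    have h2 : degree q.1 < ((k+1 : ℕ) : WithBot ℕ) := this
    have h3 := (natDegree_lt_iff_degree_lt (fun h => hq0 (Subtype.ext h))).2 h2
    omega
  · have h : T q.1 = 0 := congrArg Subtype.val (LinearMap.mem_ker.1 hq)
    rw [hT, sub_eq_zero] at h
    exact h

open Polynomial in
/-- growth of a polynomial -/
lemma poly_bound (q : ℝ[X]) (k : ℕ) (hq : q.natDegree ≤ k) :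
    ∃ C : ℝ, 0 ≤ C ∧ ∀ s : ℝ, (q.eval s)^2 ≤ C * (1 + s^2)^k := by
  have h1 : ∀ s : ℝ, |q.eval s| ≤ (∑ i ∈ range (k+1), |q.coeff i|) * Real.sqrt (1+s^2) ^ k := by
    intro s
    rw [eval_eq_sum_range' (n := k+1) (by omega), sum_mul]
    refine (abs_sum_le_sum_abs _ _).trans (sum_le_sum fun i hi => ?_)
    rw [abs_mul, abs_pow]
    refine mul_le_mul_of_nonneg_left ?_ (abs_nonneg _)
    have hs : |s| ≤ Real.sqrt (1+s^2) := Real.abs_le_sqrt (by linarith)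
    have h1s : 1 ≤ Real.sqrt (1+s^2) := Real.one_le_sqrt.2 (by nlinarith [sq_nonneg s])
    calc |s|^i ≤ Real.sqrt (1+s^2) ^ i := by gcongr
      _ ≤ _ := pow_le_pow_right₀ h1s (by have := mem_range.1 hi; omega)
  refine ⟨(∑ i ∈ range (k+1), |q.coeff i|)^2, by positivity, fun s => ?_⟩
  rw [← sq_abs]
  refine (pow_le_pow_left₀ (abs_nonneg _) (h1 s) 2).trans (le_of_eq ?_)
  rw [mul_pow, ← pow_mul, mul_comm k 2, pow_mul, Real.sq_sqrt (by positivity)]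

open Polynomial in
/-- the antiderivative used for the integration by parts -/
lemma ode_deriv (a : ℝ) (μ : ℝ) (q : ℝ[X])
    (hq : (1 + X^2) * derivative (derivative q) + C a * X * derivative q = C μ * q)
    (R r : ℝ) (hr : 0 < r) (hR : R = r^2) (F F1 F2 : ℝ → ℂ) (t : ℝ)
    (hF : HasDerivAt F (I * F1 t) t) (hF1 : HasDerivAt F1 (I * F2 t) t) :
    HasDerivAt (fun t : ℝ => (((R + t^2) ^ (a/2) : ℝ) : ℂ) *
        (((q.eval (t/r) : ℝ) : ℂ) * (I * F1 t) - (((derivative q).eval (t/r) / r : ℝ) : ℂ) * F t))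
      ((((R + t^2) ^ (-((2-a)/2)) * q.eval (t/r) : ℝ) : ℂ) *
        (-((R + t^2 : ℝ) : ℂ) * F2 t + I * (a : ℂ) * (t : ℂ) * F1 t - (μ : ℂ) * F t)) t := by
  have hpos : 0 < R + t^2 := by rw [hR]; positivity
  have hw : HasDerivAt (fun t : ℝ => (R + t^2) ^ (a/2)) (a * t * (R+t^2)^(-((2-a)/2))) t := by
    have h0 : HasDerivAt (fun t : ℝ => R + t^2) (2*t) t := by
      simpa using (hasDerivAt_pow 2 t).const_add R
    have := h0.rpow_const (p := a/2) (Or.inl hpos.ne')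
    refine this.congr_deriv ?_
    rw [show a/2 - 1 = -((2-a)/2) by ring]; ring
  have hdiv : HasDerivAt (fun t : ℝ => t/r) (1/r) t := (hasDerivAt_id t).div_const r
  have hq1 : HasDerivAt (fun t : ℝ => q.eval (t/r)) ((derivative q).eval (t/r) * (1/r)) t :=
    HasDerivAt.comp (h₂ := fun s => q.eval s) t (q.hasDerivAt (t/r)) hdiv
  have hq2 : HasDerivAt (fun t : ℝ => (derivative q).eval (t/r) / r)
      ((derivative (derivative q)).eval (t/r) * (1/r) / r) t :=
    (HasDerivAt.comp (h₂ := fun s => (derivative q).eval s) t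
      ((derivative q).hasDerivAt (t/r)) hdiv).div_const r
  have key : (1 + (t/r)^2) * (derivative (derivative q)).eval (t/r)
      + a * (t/r) * (derivative q).eval (t/r) = μ * q.eval (t/r) := by
    have := congrArg (Polynomial.eval (t/r)) hq
    simpa using this
  have hww : (R+t^2)^(a/2) = (R+t^2) * (R+t^2)^(-((2-a)/2)) := by
    rw [show a/2 = 1 + -((2-a)/2) by ring, Real.rpow_add hpos, Real.rpow_one]
  have hH := hw.ofReal_comp.mul ((hq1.ofReal_comp.mul (hF1.const_mul I)).sub (hq2.ofReal_comp.mul hF))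
  refine hH.congr_deriv ?_
  simp only [Pi.sub_apply, Pi.mul_apply]
  rw [hww]
  generalize (R+t^2)^(-((2-a)/2)) = w
  have keyC : ((1 + (t/r)^2) * (derivative (derivative q)).eval (t/r)
      + a * (t/r) * (derivative q).eval (t/r) : ℂ) = μ * q.eval (t/r) := by
    exact_mod_cast key
  generalize q.eval (t/r) = x0 at *
  generalize (derivative q).eval (t/r) = x1 at *
  generalize (derivative (derivative q)).eval (t/r) = x2 at *
  have hrc : (r:ℂ) ≠ 0 := by exact_mod_cast hr.ne'
  have hI : I * I = -1 := I_mul_I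
  push_cast
  have e1 : ((R:ℂ) + t^2) * (x2 * (1/r)/r) = μ * x0 - a * (t/r) * x1 := by
    rw [← keyC, hR]; push_cast; field_simp; ring
  linear_combination (((R:ℂ) + t^2) * w * x0 * F2 t) * hI - (w * F t) * e1

/-! ### multilinear algebra -/

/-- `i_{ξ'} e_{S0}` -/
def vv (S0 : Finset (Fin n)) (ξ : Fin n → ℝ) : Lam n :=
  WithLp.toLp 2 fun S => ∑ j ∈ Sᶜ, if insert j S = S0 then wsign j S * (ξ j : ℂ) else 0

lemma vv_apply (S0 : Finset (Fin n)) (ξ : Fin n → ℝ) (S : Finset (Fin n)) :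
    vv S0 ξ S = ∑ j ∈ Sᶜ, if insert j S = S0 then wsign j S * (ξ j : ℂ) else 0 := rfl

lemma eps_apply (x : Fin n → ℂ) (v : Lam n) (S : Finset (Fin n)) :
    eps x v S = ∑ j ∈ S, wsign j S * x j * v (S.erase j) := rfl

lemma iot_apply (x : Fin n → ℂ) (v : Lam n) (S : Finset (Fin n)) :
    iot x v S = ∑ j ∈ Sᶜ, wsign j S * x j * v (insert j S) := rfl

lemma vv_mem {S0 : Finset (Fin n)} {ℓ : Fin n} (hl : ℓ ∉ S0) (ξ : Fin n → ℝ)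
    {S : Finset (Fin n)} (hS : ℓ ∈ S) : vv S0 ξ S = 0 := by
  rw [vv_apply]
  refine sum_eq_zero fun j _ => if_neg ?_
  rintro rfl
  exact hl (mem_insert_of_mem hS)

lemma vv_card {S0 : Finset (Fin n)} {p : ℕ} (h0 : S0.card = p + 1) (ξ : Fin n → ℝ) :
    IsForm p (vv S0 ξ) := by
  intro S hS
  rw [vv_apply]
  refine sum_eq_zero fun j hj => if_neg ?_
  rintro rfl
  rw [card_insert_of_notMem (mem_compl.1 hj)] at h0
  omega

lemma vv_congr {S0 : Finset (Fin n)} {ℓ : Fin n} (hl : ℓ ∉ S0) (ξ η : Fin n → ℝ)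
    (h : ∀ j, j ≠ ℓ → ξ j = η j) : vv S0 ξ = vv S0 η := by
  ext S
  rw [vv_apply, vv_apply]
  refine sum_congr rfl fun j _ => ?_
  split_ifs with hj
  · rw [h j]
    rintro rfl
    exact hl (hj ▸ mem_insert_self _ _)
  · rfl

lemma blin_eps {S0 : Finset (Fin n)} {ℓ : Fin n} (hl : ℓ ∉ S0) (ξ : Fin n → ℝ) (w : Lam n) :
    blin (vv S0 ξ) (eps (ee ℓ) w) = 0 := by
  refine sum_eq_zero fun S _ => ?_
  by_cases hS : ℓ ∈ S
  · rw [vv_mem hl ξ hS, zero_mul]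
  · rw [eps_apply, sum_eq_zero, mul_zero]
    intro j hj
    have : j ≠ ℓ := by rintro rfl; exact hS hj
    simp [ee, this]

lemma blin_iot_eps {S0 : Finset (Fin n)} {ℓ : Fin n} (hl : ℓ ∉ S0) (ξ : Fin n → ℝ) (w : Lam n)
    (j : Fin n) (hj : j ≠ ℓ) :
    blin (vv S0 ξ) (iot (ee j) (eps (ee ℓ) w)) = 0 := by
  refine sum_eq_zero fun S _ => ?_
  by_cases hS : ℓ ∈ S
  · rw [vv_mem hl ξ hS, zero_mul]
  · rw [iot_apply, sum_eq_zero, mul_zero]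
    intro i hi
    by_cases hij : i = j
    · subst hij
      rw [eps_apply, sum_eq_zero, mul_zero]
      intro m hm
      have : m ≠ ℓ := by
        rintro rfl
        rcases mem_insert.1 hm with h | h
        · exact hj h.symm
        · exact hS h
      simp [ee, this]
    · simp [ee, hij]

lemma wsign_insert_self (j : Fin n) (T : Finset (Fin n)) : wsign j (insert j T) = wsign j T := by
  simp [wsign, filter_insert]

lemma wsign_insert {i j : Fin n} {T : Finset (Fin n)} (hj : j ∉ T) :
    wsign i (insert j T) = (if j < i then -1 else 1) * wsign i T := by
  unfold wsign
  rw [filter_insert]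
  split_ifs with h
  · rw [card_insert_of_notMem (by simp [hj]), pow_succ]; ring
  · simp

lemma vv_closed (S0 : Finset (Fin n)) (ξ : Fin n → ℝ) (T : Finset (Fin n)) :
    ∑ j ∈ Tᶜ, wsign j T * (ξ j : ℂ) * vv S0 ξ (insert j T) = 0 := by
  let f : Fin n → Fin n → ℂ := fun j i =>
    if i ≠ j then (if insert i (insert j T) = S0 then
      (wsign j T * ξ j) * (wsign i (insert j T) * ξ i) else 0) else 0
  have h1 : ∑ j ∈ Tᶜ, wsign j T * (ξ j : ℂ) * vv S0 ξ (insert j T) = ∑ j ∈ Tᶜ, ∑ i ∈ Tᶜ, f j i := by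
    refine sum_congr rfl fun j hj => ?_
    rw [vv_apply, mul_sum]
    have : (insert j T)ᶜ = Tᶜ.filter (· ≠ j) := by
      ext i; simp [and_comm]
    rw [this, sum_filter]
    refine sum_congr rfl fun i hi => ?_
    simp only [f]
    split_ifs <;> simp
  have h2 : ∀ j ∈ Tᶜ, ∀ i ∈ Tᶜ, f j i = - f i j := by
    intro j hj i hi
    have hj := mem_compl.1 hj
    have hi := mem_compl.1 hi
    simp only [f]
    by_cases hij : i = j
    · simp [hij]
    · rw [if_pos hij, if_pos (Ne.symm hij), Finset.insert_comm j i T]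
      split_ifs
      · rw [wsign_insert hj, wsign_insert hi]
        rcases lt_or_gt_of_ne hij with h | h
        · simp [h, h.not_gt]; ring
        · simp [h, h.not_gt]; ring
      · simp
  have h3 : ∑ j ∈ Tᶜ, ∑ i ∈ Tᶜ, f j i = - ∑ j ∈ Tᶜ, ∑ i ∈ Tᶜ, f j i := by
    conv_lhs => rw [sum_comm]
    rw [← sum_neg_distrib]
    refine sum_congr rfl fun i hi => ?_
    rw [← sum_neg_distrib]
    exact sum_congr rfl fun j hj => h2 j hj i hi
  rw [h1]
  exact self_eq_neg.1 h3

lemma blin_eps_sum (S0 : Finset (Fin n)) (ξ : Fin n → ℝ) (y : Lam n) :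
    blin (vv S0 ξ) (eps (rc ξ) y) = 0 := by
  have h : blin (vv S0 ξ) (eps (rc ξ) y)
      = ∑ S, ∑ j ∈ S, vv S0 ξ S * (wsign j S * ξ j * y (S.erase j)) := by
    refine sum_congr rfl fun S _ => ?_
    rw [eps_apply, mul_sum]; rfl
  have h2 : ∑ T, (∑ j ∈ Tᶜ, wsign j T * (ξ j : ℂ) * vv S0 ξ (insert j T)) * y T = 0 :=
    sum_eq_zero fun T _ => by rw [vv_closed, zero_mul]
  rw [h, ← h2]
  simp_rw [sum_mul]
  rw [sum_sigma', sum_sigma']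
  refine sum_bij' (fun x _ => ⟨x.1.erase x.2, x.2⟩) (fun x _ => ⟨insert x.2 x.1, x.2⟩) ?_ ?_ ?_ ?_ ?_
  · rintro ⟨S, j⟩ h; simp
  · rintro ⟨S, j⟩ h; simp
  · rintro ⟨S, j⟩ h
    have : j ∈ S := by simpa using h
    simp [insert_erase this]
  · rintro ⟨S, j⟩ h
    have : j ∉ S := by simpa using h
    simp [erase_insert this]
  · rintro ⟨S, j⟩ h
    have hj : j ∈ S := by simpa using h
    simp only
    rw [insert_erase hj]
    have := wsign_insert_self j (S.erase j)
    rw [insert_erase hj] at this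
    rw [this]; ring

lemma vv_bound (S0 : Finset (Fin n)) : ∃ C : ℝ, 0 ≤ C ∧ ∀ (ξ : Fin n → ℝ) (ℓ : Fin n), ℓ ∉ S0 →
    (∀ j, j ≠ ℓ → |ξ j| ≤ 2) → ‖vv S0 ξ‖^2 ≤ C := by
  refine ⟨∑ _S : Finset (Fin n), (∑ _j : Fin n, (2:ℝ))^2, by positivity, ?_⟩
  intro ξ ℓ hl hξ
  rw [EuclideanSpace.norm_sq_eq]
  refine sum_le_sum fun S _ => ?_
  refine pow_le_pow_left₀ (norm_nonneg _) ?_ 2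
  rw [vv_apply]
  refine (norm_sum_le _ _).trans ?_
  refine le_trans ?_ (sum_le_sum_of_subset_of_nonneg (subset_univ Sᶜ) (fun _ _ _ => by norm_num))
  refine sum_le_sum fun j _ => ?_
  split_ifs with h
  · have : j ≠ ℓ := by rintro rfl; exact hl (h ▸ mem_insert_self _ _)
    simpa [wsign] using hξ j this
  · simp

lemma vv_ne_zero {S0 : Finset (Fin n)} {ξ : Fin n → ℝ} {j : Fin n} (hj : j ∈ S0) (h : ξ j ≠ 0) :
    vv S0 ξ ≠ 0 := by
  intro h0
  have h1 : vv S0 ξ (S0.erase j) = 0 := by rw [h0]; rfl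
  rw [vv_apply, sum_eq_single j] at h1
  · rw [if_pos (insert_erase hj)] at h1
    simp [wsign, h] at h1
  · intro i hi hij
    refine if_neg fun hh => ?_
    have : i ∈ S0 := hh ▸ mem_insert_self _ _
    simp [this, hij] at hi
  · intro h; simp at h

lemma vv_measurable (S0 : Finset (Fin n)) : Measurable (fun ξ : Rn n => vv S0 (fun j => ξ j)) := by
  refine (WithLp.measurable_toLp _ _).comp (measurable_pi_lambda _ fun S => ?_)
  refine Finset.measurable_sum _ fun j _ => ?_
  split_ifs
  · exact (Complex.measurable_ofReal.comp (by fun_prop)).const_mul _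
  · exact measurable_const

/-- exterior multiplication as a continuous linear map -/
def epsL (x : Fin n → ℂ) : Lam n →L[ℂ] Lam n := LinearMap.toContinuousLinearMap
  { toFun := eps x
    map_add' := by
      intro v w; ext S
      simp [eps_apply, mul_add, sum_add_distrib]
    map_smul' := by
      intro c v; ext S
      simp only [eps_apply, PiLp.smul_apply, smul_eq_mul, mul_sum, RingHom.id_apply]
      exact sum_congr rfl fun j _ => by ring }

/-- interior multiplication as a continuous linear map -/
def iotL (x : Fin n → ℂ) : Lam n →L[ℂ] Lam n := LinearMap.toContinuousLinearMap
  { toFun := iot x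
    map_add' := by
      intro v w; ext S
      simp [iot_apply, mul_add, sum_add_distrib]
    map_smul' := by
      intro c v; ext S
      simp only [iot_apply, PiLp.smul_apply, smul_eq_mul, mul_sum, RingHom.id_apply]
      exact sum_congr rfl fun j _ => by ring }

/-- the pairing with a fixed vector as a continuous linear map -/
def blinL (v : Lam n) : Lam n →L[ℂ] ℂ := LinearMap.toContinuousLinearMap
  { toFun := blin v
    map_add' := by
      intro u w
      simp [blin, mul_add, sum_add_distrib]
    map_smul' := by
      intro c u
      simp only [blin, PiLp.smul_apply, smul_eq_mul, mul_sum, RingHom.id_apply]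
      exact sum_congr rfl fun j _ => by ring }

lemma epsL_apply (x : Fin n → ℂ) (v : Lam n) : epsL x v = eps x v := rfl
lemma iotL_apply (x : Fin n → ℂ) (v : Lam n) : iotL x v = iot x v := rfl
lemma blinL_apply (x : Lam n) (v : Lam n) : blinL x v = blin x v := rfl

lemma blin_smul_left (c : ℂ) (v w : Lam n) : blin (c • v) w = c * blin v w := by
  simp only [blin, PiLp.smul_apply, smul_eq_mul, mul_sum]
  exact sum_congr rfl fun j _ => by ring

/-- the B term of the operator pairs to zero -/
lemma blin_B {S0 : Finset (Fin n)} {ℓ : Fin n} (hl : ℓ ∉ S0) (ξ : Fin n → ℝ) (w : Lam n) :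
    ∑ j ∈ univ.erase ℓ, (ξ j : ℂ) * blin (vv S0 ξ)
      (iot (ee j) (eps (ee ℓ) w) + eps (ee j) (iot (ee ℓ) w)) = 0 := by
  have h1 := blin_eps_sum S0 ξ (iot (ee ℓ) w)
  have h2 : eps (rc ξ) (iot (ee ℓ) w) = ∑ j, (ξ j : ℂ) • eps (ee j) (iot (ee ℓ) w) := by
    ext S
    rw [eps_apply]
    simp only [WithLp.ofLp_sum, Finset.sum_apply, PiLp.smul_apply, smul_eq_mul, eps_apply, ee, mul_ite, mul_one, mul_zero, ite_mul,
      zero_mul, sum_ite_eq']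
    rw [sum_ite_mem, univ_inter]
    refine sum_congr rfl fun j _ => ?_
    simp only [rc]; ring
  rw [h2, ← blinL_apply, map_sum, ← add_sum_erase _ _ (mem_univ ℓ)] at h1
  simp only [map_smul, blinL_apply, blin_eps hl, smul_eq_mul, mul_zero, zero_add] at h1
  rw [← h1]
  refine sum_congr rfl fun j hj => ?_
  rw [← blinL_apply, map_add, blinL_apply, blinL_apply, blin_iot_eps hl ξ w j (ne_of_mem_erase hj),
    zero_add]

open scoped FourierTransform LineDeriv

/-- evaluation of the inverse Fourier transform as a linear functional on Schwartz space -/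
def EE (ξ : Rn n) : SchwartzMap (Rn n) (Lam n) →ₗ[ℂ] Lam n where
  toFun φ := ftInv (fun x => φ x) ξ
  map_add' φ ψ := by
    simp only [ftInv_eq]
    rw [FourierTransform.fourierInv_add, _root_.add_apply, smul_add]
  map_smul' c φ := by
    simp only [ftInv_eq, RingHom.id_apply]
    rw [FourierTransform.fourierInv_smul, _root_.smul_apply, smul_comm]

lemma EE_apply (ξ : Rn n) (φ : SchwartzMap (Rn n) (Lam n)) : EE ξ φ = ftInv (fun x => φ x) ξ := rfl

lemma EE_DD (j : Fin n) (φ : SchwartzMap (Rn n) (Lam n)) (ξ : Rn n) :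
    EE ξ (DD j φ) = (-(I * (ξ j : ℂ))) • EE ξ φ := ftInv_DD j φ ξ

lemma EE_post (M : Lam n →L[ℂ] Lam n) (φ : SchwartzMap (Rn n) (Lam n)) (ξ : Rn n) :
    EE ξ (φ.postcompCLM M) = M (EE ξ φ) := by
  simp only [EE_apply, ftInv]
  rw [← Complex.coe_smul, ← Complex.coe_smul, map_smul]
  congr 1
  rw [← ContinuousLinearMap.integral_comp_comm]
  · simp
  · refine (φ.integrable (μ := volume)).bdd_smul (𝕜 := ℂ)
      (φ := fun x : Rn n => Complex.exp ((((∑ j, x j * ξ j : ℝ) : ℂ) * Complex.I))) (C := 1) ?_ ?_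
    · exact Continuous.aestronglyMeasurable (by fun_prop)
    · refine Filter.Eventually.of_forall fun x => ?_
      rw [Complex.norm_exp_ofReal_mul_I]

lemma XX_DD (ℓ j : Fin n) (h : j ≠ ℓ) (φ : SchwartzMap (Rn n) (Lam n)) :
    XX ℓ (DD j φ) = DD j (XX ℓ φ) := by
  ext1 x
  rw [XX_apply]
  have h1 : DD j (XX ℓ φ) x = fderiv ℝ (fun y => (y ℓ) • φ y) x (EuclideanSpace.single j 1) := by
    have : (fun y : Rn n => (y ℓ) • φ y) = XX ℓ φ := by funext y; exact (XX_apply ℓ φ y).symm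
    rw [this]; rfl
  have h2 : HasFDerivAt (fun y : Rn n => y ℓ) (EuclideanSpace.proj ℓ : Rn n →L[ℝ] ℝ) x :=
    (EuclideanSpace.proj ℓ : Rn n →L[ℝ] ℝ).hasFDerivAt
  rw [h1, (h2.fun_smul (φ.differentiable x).hasFDerivAt).fderiv]
  simp [h.symm, DD, SchwartzMap.lineDerivOp_apply_eq_fderiv]

lemma dapT_schwartz (a : ℝ) (p : ℕ) (ℓ : Fin n) (μ : ℂ) (φ : SchwartzMap (Rn n) (Lam n)) :
    (fun x => DapT a p ℓ (fun y => φ y) x - μ • φ x) = fun x =>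
      (∑ j, DD j (DD j (XX ℓ (XX ℓ φ))) - (a:ℂ) • DD ℓ (XX ℓ φ)
        - (2:ℂ) • ∑ j ∈ univ.erase ℓ, (XX ℓ (DD j φ)).postcompCLM
            (iotL (ee j) ∘L epsL (ee ℓ) + epsL (ee j) ∘L iotL (ee ℓ))
        - (((n : ℝ) - 2*p : ℝ) : ℂ) • φ.postcompCLM (epsL (ee ℓ) ∘L iotL (ee ℓ)) - μ • φ :
        SchwartzMap (Rn n) (Lam n)) x := by
  funext x
  have h1 : (fun y : Rn n => ((y ℓ)^2 : ℝ) • φ y) = fun y => XX ℓ (XX ℓ φ) y := by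
    funext y; rw [XX_apply, XX_apply, smul_smul, pow_two]
  have h2 : (fun y : Rn n => (y ℓ) • φ y) = fun y => XX ℓ φ y := by
    funext y; rw [XX_apply]
  simp only [DapT, h1, h2, pd_eq]
  simp only [_root_.sub_apply, _root_.smul_apply, _root_.sum_apply,
    SchwartzMap.postcompCLM_apply, XX_apply, _root_.add_apply,
    ContinuousLinearMap.comp_apply, ContinuousLinearMap.map_smul_of_tower, epsL_apply, iotL_apply,
    Complex.coe_smul]
  congr 3
  rw [mul_smul, ← Complex.coe_smul (2:ℝ), Complex.ofReal_ofNat, smul_sum]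
  simp only [smul_add]

lemma dap_pair (a : ℝ) (p : ℕ) (ℓ : Fin n) (μ : ℂ) (φ : SchwartzMap (Rn n) (Lam n))
    (S0 : Finset (Fin n)) (hl : ℓ ∉ S0) (ξ : Rn n) :
    blin (vv S0 (fun j => ξ j)) (ftInv (fun x => DapT a p ℓ (fun y => φ y) x - μ • φ x) ξ)
    = -((∑ j, (ξ j)^2 : ℝ) : ℂ) * blin (vv S0 (fun j => ξ j)) (EE ξ (XX ℓ (XX ℓ φ)))
      + I * (a : ℂ) * (ξ ℓ : ℂ) * blin (vv S0 (fun j => ξ j)) (EE ξ (XX ℓ φ))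
      - μ * blin (vv S0 (fun j => ξ j)) (EE ξ φ) := by
  rw [dapT_schwartz, ← EE_apply, map_sub, map_sub, map_sub, map_sub, map_sum, map_smul, map_smul,
    map_smul, map_smul, map_sum]
  rw [← blinL_apply, map_sub, map_sub, map_sub, map_sub, map_sum, map_smul, map_smul, map_smul,
    map_smul, map_sum]
  have hB : ∑ j ∈ univ.erase ℓ, blinL (vv S0 (fun j => ξ j)) (EE ξ ((XX ℓ (DD j φ)).postcompCLM
            (iotL (ee j) ∘L epsL (ee ℓ) + epsL (ee j) ∘L iotL (ee ℓ)))) = 0 := by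
    have h0 := blin_B hl (fun j => ξ j) (EE ξ (XX ℓ φ))
    have h1 : ∑ j ∈ univ.erase ℓ, blinL (vv S0 (fun j => ξ j)) (EE ξ ((XX ℓ (DD j φ)).postcompCLM
            (iotL (ee j) ∘L epsL (ee ℓ) + epsL (ee j) ∘L iotL (ee ℓ)))) =
        ∑ j ∈ univ.erase ℓ, (-I) * ((ξ j : ℂ) * blin (vv S0 (fun j => ξ j))
      (iot (ee j) (eps (ee ℓ) (EE ξ (XX ℓ φ))) + eps (ee j) (iot (ee ℓ) (EE ξ (XX ℓ φ))))) := by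
      refine sum_congr rfl fun j hj => ?_
      rw [XX_DD ℓ j (ne_of_mem_erase hj), EE_post, EE_DD, map_smul, map_smul, blinL_apply,
        _root_.add_apply, ContinuousLinearMap.comp_apply,
        ContinuousLinearMap.comp_apply, epsL_apply, iotL_apply, epsL_apply, iotL_apply, smul_eq_mul]
      ring
    rw [h1, ← mul_sum, h0, mul_zero]
  rw [hB, EE_post, ContinuousLinearMap.comp_apply, epsL_apply]
  simp only [blinL_apply]
  rw [blin_eps hl, EE_DD]
  simp only [EE_DD, ← blinL_apply, map_smul, smul_eq_mul, mul_zero, sub_zero]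
  have : ∀ j, -(I * (ξ j : ℂ)) * (-(I * (ξ j : ℂ)) *
      (blinL (vv S0 (fun j => ξ j)) (EE ξ (XX ℓ (XX ℓ φ))))) =
      - ((ξ j : ℂ)^2 * (blinL (vv S0 (fun j => ξ j)) (EE ξ (XX ℓ (XX ℓ φ))))) := by
    intro j
    linear_combination ((ξ j : ℂ)^2 * (blinL (vv S0 (fun j => ξ j)) (EE ξ (XX ℓ (XX ℓ φ))))) * I_mul_I
  simp only [this]
  rw [sum_neg_distrib, ← sum_mul]
  push_cast
  ring

/-! ### measure theory and decay -/

/-- coordinates `ℝ × ℝ^m ≃ ℝ^{m+1}` splitting off the coordinate `ℓ` -/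
def emk {m : ℕ} (ℓ : Fin (m+1)) : (ℝ × (Fin m → ℝ)) ≃ᵐ Rn (m+1) :=
  (MeasurableEquiv.piFinSuccAbove (fun _ => ℝ) ℓ).symm.trans (MeasurableEquiv.toLp 2 _)

lemma emk_self {m : ℕ} (ℓ : Fin (m+1)) (z : ℝ × (Fin m → ℝ)) : emk ℓ z ℓ = z.1 := by
  change ℓ.insertNth (α := fun _ => ℝ) z.1 z.2 ℓ = z.1
  simp

lemma emk_succ {m : ℕ} (ℓ : Fin (m+1)) (z : ℝ × (Fin m → ℝ)) (i : Fin m) :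
    emk ℓ z (ℓ.succAbove i) = z.2 i := by
  change ℓ.insertNth (α := fun _ => ℝ) z.1 z.2 (ℓ.succAbove i) = z.2 i
  simp

lemma emk_mp {m : ℕ} (ℓ : Fin (m+1)) : MeasurePreserving (emk ℓ) :=
  (PiLp.volume_preserving_toLp (Fin (m+1))).comp
    ((volume_preserving_piFinSuccAbove (fun _ : Fin (m + 1) => ℝ) ℓ).symm _)

lemma emk_line {m : ℕ} (ℓ : Fin (m+1)) (t : ℝ) (y : Fin m → ℝ) :
    emk ℓ (t, y) = emk ℓ (0, y) + t • (EuclideanSpace.single ℓ 1 : Rn (m+1)) := by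
  ext j
  rcases Fin.eq_self_or_eq_succAbove ℓ j with rfl | ⟨i, rfl⟩
  · simp [emk_self]
  · simp [emk_succ]

lemma fubini_zero {m : ℕ} (ℓ : Fin (m+1)) (G : Rn (m+1) → ℂ)
    (h : ∀ y, Integrable (fun t => G (emk ℓ (t, y))) → ∫ t, G (emk ℓ (t, y)) = 0) :
    ∫ ξ, G ξ = 0 := by
  by_cases hG : Integrable G
  · rw [← (emk_mp ℓ).integral_comp (emk ℓ).measurableEmbedding]
    have h1 : Integrable (fun z => G (emk ℓ z)) :=
      ((emk_mp ℓ).integrable_comp_emb (emk ℓ).measurableEmbedding).2 hG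
    rw [Measure.volume_eq_prod] at h1 ⊢
    rw [integral_prod_symm _ h1]
    have h2 := h1.prod_left_ae
    rw [integral_congr_ae (g := fun _ => 0)]
    · simp
    · filter_upwards [h2] with y hy
      exact h y hy
  · exact integral_undef hG

lemma integrable_split {m : ℕ} (ℓ : Fin (m+1)) (f : ℝ → ℝ) (hf : Integrable f) :
    Integrable (fun ξ : Rn (m+1) =>
      f (ξ ℓ) * (Set.Icc (1 : Fin m → ℝ) 2).indicator (fun _ => (1:ℝ)) (fun i => ξ (ℓ.succAbove i))) := by
  rw [← (emk_mp ℓ).integrable_comp_emb (emk ℓ).measurableEmbedding]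
  have h1 : Integrable ((Set.Icc (1 : Fin m → ℝ) 2).indicator (fun _ => (1:ℝ))) := by
    rw [integrable_indicator_iff measurableSet_Icc]
    exact integrableOn_const (hs := by exact isCompact_Icc.measure_lt_top.ne)
  have h2 := hf.mul_prod h1
  rw [← Measure.volume_eq_prod] at h2
  refine h2.congr (Filter.Eventually.of_forall fun z => ?_)
  simp only [Function.comp, emk_self, emk_succ]

open Polynomial in
lemma decay (v : Lam n) (ℓ : Fin n) (ξ : Rn n) (hξ : ξ ℓ = 0) (P : ℝ[X]) :
    ∀ ψ : SchwartzMap (Rn n) (Lam n),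
    Filter.Tendsto (fun t : ℝ => ((P.eval t : ℝ) : ℂ) *
      blinL v (EE (ξ + t • (EuclideanSpace.single ℓ 1 : Rn n)) ψ)) (Filter.cocompact ℝ) (nhds 0) := by
  have hb : ∀ ψ : SchwartzMap (Rn n) (Lam n), Filter.Tendsto (fun t : ℝ =>
      blinL v (EE (ξ + t • (EuclideanSpace.single ℓ 1 : Rn n)) ψ)) (Filter.cocompact ℝ) (nhds 0) := by
    intro ψ
    have := ((blinL v).continuous.tendsto 0).comp
      ((ftInv_tendsto ψ).comp (line_tendsto ℓ ξ))
    rw [map_zero] at this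
    exact this
  induction P using Polynomial.induction_on' with
  | add p q hp hq =>
    intro ψ
    have := (hp ψ).add (hq ψ)
    rw [add_zero] at this
    refine this.congr fun t => ?_
    rw [eval_add]; push_cast; ring
  | monomial k c =>
    induction k with
    | zero =>
      intro ψ
      have := (hb ψ).const_mul (c : ℂ)
      rw [mul_zero] at this
      refine this.congr fun t => ?_
      simp
    | succ k ih =>
      intro ψ
      have := (ih (DD ℓ ψ)).const_mul I
      rw [mul_zero] at this
      refine this.congr fun t => ?_
      rw [EE_DD, map_smul, smul_eq_mul]
      simp only [PiLp.add_apply, PiLp.smul_apply, hξ, eval_monomial]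
      simp only [PiLp.single_apply, if_true, smul_eq_mul, mul_one, zero_add]
      push_cast
      linear_combination (-(c * (t:ℂ)^k * t *
        blinL v (EE (ξ + t • (EuclideanSpace.single ℓ 1 : Rn n)) ψ))) * I_mul_I

open Polynomial in
lemma line_zero_aux (a : ℝ) (ha : a ≤ 2) (μ : ℝ) (q : ℝ[X])
    (hq : (1 + X^2) * derivative (derivative q) + C a * X * derivative q = C μ * q)
    (R : ℝ) (hR : 1 ≤ R) (F F1 F2 : ℝ → ℂ) (hF : ∀ t, HasDerivAt F (I * F1 t) t)
    (hF1 : ∀ t, HasDerivAt F1 (I * F2 t) t)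
    (hd : ∀ P : ℝ[X], Filter.Tendsto (fun t : ℝ => ((P.eval t : ℝ) : ℂ) * F t)
      (Filter.cocompact ℝ) (nhds 0))
    (hd1 : ∀ P : ℝ[X], Filter.Tendsto (fun t : ℝ => ((P.eval t : ℝ) : ℂ) * F1 t)
      (Filter.cocompact ℝ) (nhds 0))
    (G : ℝ → ℂ) (hGi : Integrable G)
    (hG : ∀ t, G t = (((R + t^2) ^ (-((2-a)/2)) * q.eval (t/Real.sqrt R) : ℝ) : ℂ) *
        (-((R + t^2 : ℝ) : ℂ) * F2 t + I * (a : ℂ) * (t : ℂ) * F1 t - (μ : ℂ) * F t)) :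
    ∫ t, G t = 0 := by
  obtain ⟨r, hr⟩ : ∃ r, r = Real.sqrt R := ⟨_, rfl⟩
  rw [← hr] at hG
  have hr0 : 0 < r := hr ▸ Real.sqrt_pos.2 (by linarith)
  have hRr : R = r^2 := by rw [hr]; exact (Real.sq_sqrt (by linarith)).symm
  have hH := fun t => ode_deriv a μ q hq R r hr0 hRr F F1 F2 t (hF t) (hF1 t)
  have hlim : Filter.Tendsto (fun t : ℝ => (((R + t^2) ^ (a/2) : ℝ) : ℂ) *
        (((q.eval (t/r) : ℝ) : ℂ) * (I * F1 t)
        - (((derivative q).eval (t/r) / r : ℝ) : ℂ) * F t))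
        (Filter.cocompact ℝ) (nhds 0) := by
    have d1 := (hd1 ((C R + X^2) * q.comp (C r⁻¹ * X))).const_mul I
    have d2 := hd ((C R + X^2) * (C r⁻¹ * (derivative q).comp (C r⁻¹ * X)))
    have d3 := (d1.sub d2).norm
    simp only [mul_zero, sub_zero, norm_zero] at d3
    refine squeeze_zero_norm (fun t => ?_) d3
    have hpos : 1 ≤ R + t^2 := by nlinarith [sq_nonneg t]
    have e : I * (((eval t ((C R + X^2) * q.comp (C r⁻¹ * X)) : ℝ) : ℂ) * F1 t) -
        ((eval t ((C R + X^2) * (C r⁻¹ * (derivative q).comp (C r⁻¹ * X))) : ℝ) : ℂ) * F t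
      = ((R + t^2 : ℝ) : ℂ) * (((q.eval (t/r) : ℝ) : ℂ) * (I * F1 t)
        - (((derivative q).eval (t/r) / r : ℝ) : ℂ) * F t) := by
      have e0 : r⁻¹ * t = t / r := by ring
      simp only [eval_mul, eval_add, eval_C, eval_pow, eval_X, eval_comp, e0]
      push_cast
      ring
    rw [e, norm_mul, norm_mul]
    refine mul_le_mul_of_nonneg_right ?_ (norm_nonneg _)
    rw [Complex.norm_real, Complex.norm_real, Real.norm_of_nonneg (by positivity),
      Real.norm_of_nonneg (by positivity)]
    calc (R+t^2)^(a/2) ≤ (R+t^2)^(1:ℝ) := Real.rpow_le_rpow_of_exponent_le hpos (by linarith)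
      _ = _ := Real.rpow_one _
  rw [cocompact_eq_atBot_atTop, Filter.tendsto_sup] at hlim
  have hfin := integral_of_hasDerivAt_of_tendsto (f' := G)
    (fun t => (hH t).congr_deriv (hG t).symm) hGi hlim.1 hlim.2
  rw [hfin, sub_zero]

lemma line_deriv (v : Lam n) (ℓ : Fin n) (ξ : Rn n) (ψ : SchwartzMap (Rn n) (Lam n)) (t : ℝ) :
    HasDerivAt (fun t : ℝ => blinL v (EE (ξ + t • (EuclideanSpace.single ℓ 1 : Rn n)) ψ))
      (I * blinL v (EE (ξ + t • (EuclideanSpace.single ℓ 1 : Rn n)) (XX ℓ ψ))) t := by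
  have h := ((blinL v).restrictScalars ℝ).hasFDerivAt.comp_hasDerivAt t (ftInv_XX ℓ ψ ξ t)
  refine h.congr_deriv ?_
  rw [ContinuousLinearMap.coe_restrictScalars', map_smul, smul_eq_mul, EE_apply]

open Polynomial in
lemma line_zero (a : ℝ) (ha : a ≤ 2) (μ : ℝ) (q : ℝ[X])
    (hq : (1 + X^2) * derivative (derivative q) + C a * X * derivative q = C μ * q)
    (R : ℝ) (hR : 1 ≤ R) (v : Lam n) (ℓ : Fin n) (ξ : Rn n) (hξ : ξ ℓ = 0)
    (φ : SchwartzMap (Rn n) (Lam n)) (G : ℝ → ℂ) (hGi : Integrable G)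
    (hG : ∀ t, G t = (((R + t^2) ^ (-((2-a)/2)) * q.eval (t/Real.sqrt R) : ℝ) : ℂ) *
        (-((R + t^2 : ℝ) : ℂ) * blinL v (EE (ξ + t • (EuclideanSpace.single ℓ 1 : Rn n)) (XX ℓ (XX ℓ φ)))
          + I * (a : ℂ) * (t : ℂ) * blinL v (EE (ξ + t • (EuclideanSpace.single ℓ 1 : Rn n)) (XX ℓ φ))
          - (μ : ℂ) * blinL v (EE (ξ + t • (EuclideanSpace.single ℓ 1 : Rn n)) φ))) :
    ∫ t, G t = 0 :=
  line_zero_aux a ha μ q hq R hR _ _ _ (line_deriv v ℓ ξ φ) (line_deriv v ℓ ξ (XX ℓ φ))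
    (fun P => decay v ℓ ξ hξ P φ) (fun P => decay v ℓ ξ hξ P (XX ℓ φ)) G hGi hG

/-! ### the eigenfunction -/

/-- `|ξ'|²` -/
def RR (ℓ : Fin n) (ξ : Rn n) : ℝ := ∑ j ∈ univ.erase ℓ, (ξ j)^2

/-- the scalar factor of the eigenfunction -/
def hh (a : ℝ) (q : Polynomial ℝ) (ℓ : Fin n) (ξ : Rn n) : ℝ :=
  (RR ℓ ξ + (ξ ℓ)^2) ^ (-((2-a)/2)) * q.eval (ξ ℓ / Real.sqrt (RR ℓ ξ))

/-- the cutoff region -/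
def QQ (ℓ : Fin n) : Set (Rn n) := {ξ | ∀ j, j ≠ ℓ → 1 ≤ ξ j ∧ ξ j ≤ 2}

open Classical in
/-- the Fourier transform of the eigenfunction -/
def gg (a : ℝ) (q : Polynomial ℝ) (ℓ : Fin n) (S0 : Finset (Fin n)) (ξ : Rn n) : Lam n :=
  if ξ ∈ QQ ℓ then (hh a q ℓ ξ : ℂ) • vv S0 (fun j => ξ j) else 0

lemma RR_add (ℓ : Fin n) (ξ : Rn n) : RR ℓ ξ + (ξ ℓ)^2 = ∑ j, (ξ j)^2 :=
  sum_erase_add _ _ (mem_univ ℓ)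

lemma RR_ge (ℓ : Fin n) (hn : 2 ≤ n) (ξ : Rn n) (h : ξ ∈ QQ ℓ) : 1 ≤ RR ℓ ξ := by
  have : (univ.erase ℓ).Nonempty := by
    rw [← card_pos, card_erase_of_mem (mem_univ _)]; simp; omega
  obtain ⟨j, hj⟩ := this
  have h1 := h j (ne_of_mem_erase hj)
  have h2 : (ξ j)^2 ≤ RR ℓ ξ :=
    single_le_sum (f := fun j => (ξ j)^2) (fun i _ => sq_nonneg _) hj
  nlinarith

lemma RR_cont (ℓ : Fin n) : Continuous (RR ℓ) := by
  unfold RR; fun_prop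

lemma QQ_meas (ℓ : Fin n) : MeasurableSet (QQ ℓ) := by
  have : QQ ℓ = ⋂ j, ⋂ (_ : j ≠ ℓ), {ξ : Rn n | 1 ≤ ξ j ∧ ξ j ≤ 2} := by
    ext ξ; simp [QQ]
  rw [this]
  refine MeasurableSet.iInter fun j => MeasurableSet.iInter fun _ => ?_
  have hc : Measurable (fun ξ : Rn n => ξ j) := by fun_prop
  exact (measurableSet_le measurable_const hc).inter (measurableSet_le hc measurable_const)

lemma gg_meas (a : ℝ) (q : Polynomial ℝ) (ℓ : Fin n) (S0 : Finset (Fin n)) :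
    Measurable (gg a q ℓ S0) := by
  refine Measurable.ite (QQ_meas ℓ) ?_ measurable_const
  refine Measurable.smul (Complex.measurable_ofReal.comp ?_) (vv_measurable S0)
  have h1 : Measurable (RR ℓ) := (RR_cont ℓ).measurable
  unfold hh
  have hc : Measurable (fun ξ : Rn n => ξ ℓ) := by fun_prop
  refine Measurable.mul (Measurable.pow_const (h1.add (hc.pow_const 2)) _) ?_
  exact q.continuous.measurable.comp (hc.div h1.sqrt)

lemma gg_integrable {m : ℕ} (a : ℝ) (q : Polynomial ℝ) (ℓ : Fin (m+1)) (S0 : Finset (Fin (m+1)))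
    (hl : ℓ ∉ S0) (hm : 2 ≤ m + 1) (k : ℕ) (hk : (k:ℝ) < (1-a)/2) (hq : q.natDegree ≤ k) :
    Integrable (fun ξ : Rn (m+1) => ‖ξ‖ ^ (2*((2-a)/2)) * ‖gg a q ℓ S0 ξ‖^2) := by
  obtain ⟨Cq, hCq, hCq'⟩ := poly_bound q k hq
  obtain ⟨Cv, hCv, hCv'⟩ := vv_bound S0
  have hintg : Integrable (fun t : ℝ => (Cq * Cv) * ((1 : ℝ) + ‖t‖ ^ 2) ^ (-(2 - a - 2*k) / 2)) := by
    refine (integrable_rpow_neg_one_add_norm_sq ?_).const_mul _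
    rw [Module.finrank_self]; push_cast; linarith
  refine (integrable_split ℓ _ hintg).mono' ?_ (Filter.Eventually.of_forall fun ξ => ?_)
  · refine Measurable.aestronglyMeasurable ?_
    exact (measurable_norm.pow_const _).mul ((gg_meas a q ℓ S0).norm.pow_const 2)
  · rw [Real.norm_of_nonneg (by positivity)]
    by_cases hξ : ξ ∈ QQ ℓ
    · have hR := RR_ge ℓ hm ξ hξ
      have hmem : (fun i => ξ (ℓ.succAbove i)) ∈ Set.Icc (1 : Fin m → ℝ) 2 :=
        ⟨fun i => (hξ _ (Fin.succAbove_ne ℓ i)).1, fun i => (hξ _ (Fin.succAbove_ne ℓ i)).2⟩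
      rw [Set.indicator_of_mem hmem, mul_one]
      have hv := hCv' (fun j => ξ j) ℓ hl (fun j hj => by
        have := hξ j hj
        rw [abs_le]; constructor <;> linarith)
      simp only [gg, if_pos hξ, norm_smul, Complex.norm_real, mul_pow, Real.norm_eq_abs, sq_abs]
      have hnorm : ‖ξ‖ ^ (2*((2-a)/2)) = (RR ℓ ξ + (ξ ℓ)^2) ^ ((2-a)/2) := by
        rw [RR_add, Real.rpow_mul (norm_nonneg _)]
        congr 1
        rw [Real.rpow_two, EuclideanSpace.norm_sq_eq]
        simp
      rw [hnorm, hh, mul_pow]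
      set R := RR ℓ ξ
      set t := ξ ℓ
      have hpos : 0 < R + t^2 := by nlinarith [sq_nonneg t]
      have hq2 : (q.eval (t / Real.sqrt R))^2 ≤ Cq * (R + t^2)^k := by
        refine (hCq' _).trans (mul_le_mul_of_nonneg_left ?_ hCq)
        refine pow_le_pow_left₀ (by positivity) ?_ k
        rw [div_pow, Real.sq_sqrt (by linarith)]
        have : t^2 / R ≤ t^2 := div_le_self (sq_nonneg _) hR
        linarith
      have e1 : (R + t^2) ^ ((2-a)/2) * ((R + t^2) ^ (-((2-a)/2)))^2 = (R + t^2) ^ (-((2-a)/2)) := by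
        rw [pow_two ((R + t^2) ^ (-((2-a)/2))), ← mul_assoc, ← Real.rpow_add hpos, add_neg_cancel, Real.rpow_zero, one_mul]
      have e2 : (R + t^2) ^ (-((2-a)/2)) * (R + t^2)^k = (R+t^2) ^ (-(2 - a - 2*k) / 2) := by
        rw [← Real.rpow_natCast (R + t^2) k, ← Real.rpow_add hpos]; congr 1; ring
      have e3 : (R+t^2) ^ (-(2 - a - 2*k) / 2) ≤ (1 + t^2) ^ (-(2 - a - 2*k) / 2) := by
        refine Real.rpow_le_rpow_of_nonpos (by positivity) (by linarith) (by linarith)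
      calc (R + t^2) ^ ((2-a)/2) * (((R + t^2) ^ (-((2-a)/2)))^2 * (q.eval (t / Real.sqrt R))^2
            * ‖vv S0 (fun j => ξ j)‖^2)
          = (R + t^2) ^ (-((2-a)/2)) * ((q.eval (t / Real.sqrt R))^2 * ‖vv S0 (fun j => ξ j)‖^2) := by
            linear_combination ((q.eval (t / Real.sqrt R))^2 * ‖vv S0 (fun j => ξ j)‖^2) * e1
        _ ≤ (R + t^2) ^ (-((2-a)/2)) * ((Cq * (R + t^2)^k) * Cv) := by gcongr
        _ = (Cq * Cv) * (R+t^2) ^ (-(2 - a - 2*k) / 2) := by rw [← e2]; ring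
        _ ≤ _ := mul_le_mul_of_nonneg_left e3 (by positivity)
    · simp only [gg, if_neg hξ]
      rw [norm_zero, zero_pow two_ne_zero, mul_zero]
      refine mul_nonneg (by positivity) (Set.indicator_nonneg (fun _ _ => zero_le_one) _)

lemma gg_ne (a : ℝ) (q : Polynomial ℝ) (hq : q ≠ 0) (ℓ : Fin n) (S0 : Finset (Fin n))
    (hl : ℓ ∉ S0) (h0 : S0.Nonempty) (hn : 2 ≤ n) : ¬ (∀ᵐ ξ, gg a q ℓ S0 ξ = 0) := by
  intro hae
  obtain ⟨j0, hj0⟩ := h0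
  have hj0l : j0 ≠ ℓ := by rintro rfl; exact hl hj0
  obtain ⟨s, hs⟩ : ∃ s, q.eval s ≠ 0 := by
    by_contra hcon
    push Not at hcon
    exact hq (Polynomial.funext (by simpa using hcon))
  let V : Set (Rn n) := {ξ | ∀ j, j ≠ ℓ → 1 < ξ j ∧ ξ j < 2}
  have hV : IsOpen V := by
    have : V = ⋂ j, ⋂ (_ : j ≠ ℓ), {ξ : Rn n | 1 < ξ j ∧ ξ j < 2} := by
      ext ξ; simp [V]
    rw [this]
    refine isOpen_iInter_of_finite fun j => isOpen_iInter_of_finite fun _ => ?_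
    have hc : Continuous (fun ξ : Rn n => ξ j) := by fun_prop
    exact (isOpen_lt continuous_const hc).inter (isOpen_lt hc continuous_const)
  have hVQ : V ⊆ QQ ℓ := fun ξ h j hj => ⟨(h j hj).1.le, (h j hj).2.le⟩
  have hf : ContinuousOn (fun ξ : Rn n => q.eval (ξ ℓ / Real.sqrt (RR ℓ ξ))) V := by
    refine q.continuous.comp_continuousOn (ContinuousOn.div (by fun_prop)
      (RR_cont ℓ).sqrt.continuousOn fun ξ h => ?_)
    have := RR_ge ℓ hn ξ (hVQ h)
    exact (Real.sqrt_pos.2 (by linarith)).ne'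
  have hU := hf.isOpen_inter_preimage hV (isOpen_compl_singleton (x := (0:ℝ)))
  have hUne : (V ∩ (fun ξ : Rn n => q.eval (ξ ℓ / Real.sqrt (RR ℓ ξ))) ⁻¹' {0}ᶜ).Nonempty := by
    let ρ : ℝ := ∑ _j ∈ univ.erase ℓ, (3/2:ℝ)^2
    let ξ : Rn n := WithLp.toLp 2 fun j => if j = ℓ then s * Real.sqrt ρ else 3/2
    have hξV : ξ ∈ V := by
      intro j hj
      simp only [ξ, if_neg hj]; norm_num
    have hρ : RR ℓ ξ = ρ := by
      refine sum_congr rfl fun j hj => ?_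
      simp only [ξ, if_neg (ne_of_mem_erase hj)]
    refine ⟨ξ, hξV, ?_⟩
    have h1 := RR_ge ℓ hn ξ (hVQ hξV)
    have h2 : Real.sqrt ρ ≠ 0 := (Real.sqrt_pos.2 (by rw [hρ] at h1; linarith)).ne'
    have h3 : ξ ℓ / Real.sqrt (RR ℓ ξ) = s := by
      rw [hρ]; simp only [ξ, if_true]; field_simp
    simp only [Set.mem_preimage, Set.mem_compl_iff, Set.mem_singleton_iff, h3]
    exact hs
  have hpos := hU.measure_pos volume hUne
  refine hpos.ne' (measure_mono_null ?_ (ae_iff.1 hae))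
  rintro ξ ⟨hξ, hξ2⟩
  have hR := RR_ge ℓ hn ξ (hVQ hξ)
  simp only [Set.mem_ofPred_eq, gg, if_pos (hVQ hξ)]
  refine smul_ne_zero ?_ (vv_ne_zero hj0 (by have := (hξ j0 hj0l).1; exact (by linarith : (0:ℝ) < ξ j0).ne'))
  have : hh a q ℓ ξ ≠ 0 :=
    mul_ne_zero (Real.rpow_pos_of_pos (by nlinarith [sq_nonneg (ξ ℓ)]) _).ne' hξ2
  exact_mod_cast this

open Polynomial in
lemma gg_weak {m : ℕ} (a : ℝ) (ha : a ≤ 2) (p : ℕ) (μ : ℝ) (q : ℝ[X])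
    (hq : (1 + X^2) * derivative (derivative q) + C a * X * derivative q = C μ * q)
    (ℓ : Fin (m+1)) (S0 : Finset (Fin (m+1))) (hl : ℓ ∉ S0) (hm : 2 ≤ m + 1) :
    WeakEig a p ℓ (gg a q ℓ S0) (μ : ℂ) := by
  intro φ
  refine fubini_zero ℓ _ fun y hy => ?_
  have hRc : ∀ t, RR ℓ (emk ℓ (t,y)) = RR ℓ (emk ℓ (0,y)) := by
    intro t
    refine sum_congr rfl fun j hj => ?_
    obtain ⟨i, rfl⟩ := (Fin.eq_self_or_eq_succAbove ℓ j).resolve_left (ne_of_mem_erase hj)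
    rw [emk_succ, emk_succ]
  have hQc : ∀ t, emk ℓ (t,y) ∈ QQ ℓ ↔ emk ℓ (0,y) ∈ QQ ℓ := by
    intro t
    refine forall_congr' fun j => imp_congr_right fun hj => ?_
    obtain ⟨i, rfl⟩ := (Fin.eq_self_or_eq_succAbove ℓ j).resolve_left hj
    rw [emk_succ, emk_succ]
  by_cases hQ : emk ℓ (0,y) ∈ QQ ℓ
  · refine line_zero a ha μ q hq (RR ℓ (emk ℓ (0,y))) (RR_ge ℓ hm _ hQ)
      (vv S0 (fun j => emk ℓ (0,y) j)) ℓ (emk ℓ (0,y)) (emk_self _ _) φ _ hy fun t => ?_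
    rw [← emk_line]
    have hv : vv S0 (fun j => emk ℓ (t,y) j) = vv S0 (fun j => emk ℓ (0,y) j) := by
      refine vv_congr hl _ _ fun j hj => ?_
      obtain ⟨i, rfl⟩ := (Fin.eq_self_or_eq_succAbove ℓ j).resolve_left hj
      simp only [emk_succ]
    simp only [gg, if_pos ((hQc t).2 hQ)]
    rw [blin_smul_left, dap_pair a p ℓ μ φ S0 hl, ← RR_add ℓ, hRc, hv, hh, hRc, emk_self]
    rfl
  · have : (fun t => blin (gg a q ℓ S0 (emk ℓ (t,y)))
        (ftInv (fun x => DapT a p ℓ (fun y => φ y) x - (μ:ℂ) • φ x) (emk ℓ (t,y)))) = fun _ => 0 := by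
      funext t
      simp only [gg, if_neg (mt (hQc t).1 hQ)]
      simp [blin]
    rw [this]; simp

end Aux

/-- the point spectrum of the self-adjoint closure of Δ_{a,p} on
Ḣ^{(2-a)/2,p}(ℝ^n) contains {k(k+a-1) : k ∈ ℕ, k < (1-a)/2}: for every such k there is a
nonzero u ∈ Ḣ^{(2-a)/2,p}(ℝ^n) with Δ_{a,p} u = k(k+a-1) u in the sense of tempered
distributions. (All expressed on the Fourier transform side, g = û.) -/
theorem stmt5 (n p : ℕ) (hn : 2 ≤ n) (hp : 2*p ≤ n)
    (a : ℝ) (ha1 : 2 - (n:ℝ) + 2*p < a) (ha2 : a ≤ 2)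
    (ℓ : Fin n) (hℓ : (ℓ : ℕ) = n - 1)
    (k : ℕ) (hk : (k:ℝ) < (1-a)/2) :
    ∃ g ∈ Hdot n ((2-a)/2) p, ¬ (∀ᵐ ξ, g ξ = 0) ∧
      WeakEig a p ℓ g ((((k:ℝ) * ((k:ℝ) + a - 1)) : ℝ) : ℂ) := by
  obtain ⟨m, rfl⟩ : ∃ m, n = m + 1 := ⟨n - 1, by omega⟩
  have hk0 : (0:ℝ) ≤ k := k.cast_nonneg
  have hpm : 2 * p + 1 < m + 1 := by
    have : (2 * p + 1 : ℝ) < ((m + 1 : ℕ) : ℝ) := by linarith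
    exact_mod_cast this
  have hc : p + 1 ≤ (univ.erase ℓ).card := by
    rw [card_erase_of_mem (mem_univ _), card_univ, Fintype.card_fin]; omega
  obtain ⟨S0, hS, hcard⟩ := exists_subset_card_eq hc
  have hl : ℓ ∉ S0 := fun h => (notMem_erase ℓ univ) (hS h)
  have h0 : S0.Nonempty := by rw [← card_pos, hcard]; omega
  obtain ⟨q, hq0, hqd, hqe⟩ := exists_poly a k
  refine ⟨gg a q ℓ S0, ⟨(gg_meas a q ℓ S0).aestronglyMeasurable, fun ξ => ?_,
    gg_integrable a q ℓ S0 hl hn k hk hqd⟩, gg_ne a q hq0 ℓ S0 hl h0 hn,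
    gg_weak a ha2 p _ q hqe ℓ S0 hl hn⟩
  have hv := vv_card (S0 := S0) (ξ := fun j => (ξ j : ℝ)) hcard
  intro T hT
  unfold gg
  split_ifs
  · simp [hv T hT]
  · rfl
end
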